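/- A finite non-orthogonal set of pure states on a finite-dimensional complex Hilbert space that is maximally contextual is strongly antidistinguishable. -/

import Mathlib

open Matrix

/-- Square complex matrices of size `d`, acting on the Hilbert space `ℂ^d`. -/
abbrev Mat (d : ℕ) := Matrix (Fin d) (Fin d) ℂ

/-- An orthogonal projection. -/
def IsProjection {d : ℕ} (p : Mat d) : Prop := p.IsHermitian ∧ p * p = p

/-- A pure state: a rank-1 orthogonal projection `|ψ⟩⟨ψ|` for a unit vector `ψ`. -/
def IsPureState {d : ℕ} (ρ : Mat d) : Prop :=
  ∃ ψ : Fin d → ℂ, star ψ ⬝ᵥ ψ = 1 ∧ ρ = vecMulVec ψ (star ψ)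

/-- A PVM: a finite family of orthogonal projections, pairwise orthogonal, summing to `1`. -/
def IsPVM {d : ℕ} (P : Finset (Mat d)) : Prop :=
  (∀ p ∈ P, IsProjection p) ∧
  (∀ p ∈ P, ∀ q ∈ P, p ≠ q → p * q = 0) ∧
  ∑ p ∈ P, p = 1

/-- A PVM given as an indexed family. -/
def IsPVMFam {d : ℕ} {ι : Type} [Fintype ι] (π : ι → Mat d) : Prop :=
  (∀ i, IsProjection (π i)) ∧ (∀ i j, i ≠ j → π i * π j = 0) ∧ ∑ i, π i = 1

/-- `P` weakly antidistinguishes `S`: every outcome of `P` excludes some state of `S`. -/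
def WeaklyAntidistinguishes {d : ℕ} (P S : Finset (Mat d)) : Prop :=
  ∀ p ∈ P, ∃ ρ ∈ S, (p * ρ).trace = 0

/-- `S` is weakly antidistinguishable. -/
def IsWA {d : ℕ} (S : Finset (Mat d)) : Prop :=
  ∃ P : Finset (Mat d), IsPVM P ∧ WeaklyAntidistinguishes P S

/-- `P` strongly antidistinguishes `S`: it weakly antidistinguishes `S` and for each state
there is an outcome excluding that state and no other. -/
def StronglyAntidistinguishes {d : ℕ} (P S : Finset (Mat d)) : Prop :=
  WeaklyAntidistinguishes P S ∧
  ∀ ρ ∈ S, ∃ p ∈ P, (p * ρ).trace = 0 ∧ ∀ ρ' ∈ S, ρ' ≠ ρ → (p * ρ').trace ≠ 0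

/-- `S` is strongly antidistinguishable. -/
def IsSA {d : ℕ} (S : Finset (Mat d)) : Prop :=
  ∃ P : Finset (Mat d), IsPVM P ∧ StronglyAntidistinguishes P S

/-- `S = {ρ_1, …, ρ_N}` is antidistinguishable: there is a PVM `{π_i}_{i=1}^N`, with one
outcome per state, such that `Tr(π_i ρ_i) = 0` for each `i`. -/
def IsA {d : ℕ} (S : Finset (Mat d)) : Prop :=
  ∃ π : Mat d → Mat d,
    (∀ ρ ∈ S, IsProjection (π ρ)) ∧
    (∀ ρ ∈ S, ∀ ρ' ∈ S, ρ ≠ ρ' → π ρ * π ρ' = 0) ∧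
    (∑ ρ ∈ S, π ρ = 1) ∧
    ∀ ρ ∈ S, (π ρ * ρ).trace = 0

/-- A context: a finite set of rank-1 orthogonal projections, pairwise orthogonal,
summing to the identity. -/
def IsContext {d : ℕ} (C : Finset (Mat d)) : Prop :=
  (∀ p ∈ C, IsPureState p) ∧
  (∀ p ∈ C, ∀ q ∈ C, p ≠ q → p * q = 0) ∧
  ∑ p ∈ C, p = 1

/-- A `{0,1}`-valued assignment on `X` such that every context drawn from `X`
has exactly one vertex assigned the value `1`. -/
def NoncontextualAssignment {d : ℕ} (X : Finset (Mat d)) (ν : Mat d → ℕ) : Prop :=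
  (∀ σ ∈ X, ν σ = 0 ∨ ν σ = 1) ∧
  ∀ C ⊆ X, IsContext C → ∑ σ ∈ C, ν σ = 1

/-- `σ` is an implied projector of `S`: a rank-1 projection orthogonal to some state of `S`. -/
def ImpliedProjector {d : ℕ} (S : Finset (Mat d)) (σ : Mat d) : Prop :=
  IsPureState σ ∧ ∃ ρ ∈ S, ρ * σ = 0

/-- `X` is a contextuality scenario generated by `S`: a finite set of rank-1 projections
with `S ⊆ X` and `X \ S ⊆ I(S)`. -/
def GeneratedScenario {d : ℕ} (S X : Finset (Mat d)) : Prop :=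
  (∀ σ ∈ X, IsPureState σ) ∧ S ⊆ X ∧ ∀ σ ∈ X, σ ∉ S → ImpliedProjector S σ

/-- `S` is a contextual instance of the scenario `X`: there is no noncontextual value
assignment on `X` assigning `1` to every state of `S`. -/
def ContextualInstance {d : ℕ} (S X : Finset (Mat d)) : Prop :=
  ¬ ∃ ν : Mat d → ℕ, NoncontextualAssignment X ν ∧ ∀ ρ ∈ S, ν ρ = 1

/-- `S` is contextual: some scenario generated by `S` has `S` as a contextual instance. -/
def IsContextualSet {d : ℕ} (S : Finset (Mat d)) : Prop :=
  ∃ X : Finset (Mat d), GeneratedScenario S X ∧ ContextualInstance S X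

/-- `S` is non-orthogonal: distinct states have nonzero overlap. -/
def NonOrthogonal {d : ℕ} (S : Finset (Mat d)) : Prop :=
  ∀ ρ ∈ S, ∀ ρ' ∈ S, ρ ≠ ρ' → (ρ * ρ').trace ≠ 0

/-- `S` is maximally contextual: `S` is contextual and no proper subset of `S` is. -/
def MaximallyContextual {d : ℕ} (S : Finset (Mat d)) : Prop :=
  IsContextualSet S ∧ ∀ S' ⊂ S, ¬ IsContextualSet S'

lemma vecMulVec_mul_vecMulVec_star {d : ℕ} (u v : Fin d → ℂ) :
    vecMulVec u (star u) * vecMulVec v (star v) = (star u ⬝ᵥ v) • vecMulVec u (star v) := by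
  ext i j
  simp only [Matrix.mul_apply, vecMulVec_apply, Matrix.smul_apply, dotProduct, smul_eq_mul,
    Finset.sum_mul]
  exact Finset.sum_congr rfl fun k _ => by ring

lemma trace_vecMulVec_mul_vecMulVec_star {d : ℕ} (u v : Fin d → ℂ) :
    (vecMulVec u (star u) * vecMulVec v (star v)).trace =
      (star u ⬝ᵥ v) * star (star u ⬝ᵥ v) := by
  rw [vecMulVec_mul_vecMulVec_star, trace_smul, trace_vecMulVec, smul_eq_mul, star_dotProduct,
    star_star, dotProduct_comm u]

lemma IsPureState.isProjection {d : ℕ} {ρ : Mat d} (h : IsPureState ρ) : IsProjection ρ := by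
  obtain ⟨ψ, hψ, rfl⟩ := h
  refine ⟨?_, by rw [vecMulVec_mul_vecMulVec_star, hψ, one_smul]⟩
  ext i j
  simp [vecMulVec_apply, mul_comm]

lemma IsPureState.ne_zero {d : ℕ} {ρ : Mat d} (h : IsPureState ρ) : ρ ≠ 0 := by
  obtain ⟨ψ, hψ, rfl⟩ := h
  intro h0
  have ht := trace_vecMulVec_mul_vecMulVec_star ψ ψ
  simp [h0, hψ] at ht

/-- For pure states, vanishing overlap is the same as orthogonality. -/
lemma IsPureState.trace_mul_eq_zero_iff {d : ℕ} {ρ σ : Mat d} (hρ : IsPureState ρ)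
    (hσ : IsPureState σ) : (ρ * σ).trace = 0 ↔ ρ * σ = 0 := by
  refine ⟨fun h => ?_, fun h => by rw [h, trace_zero]⟩
  obtain ⟨ψ, -, rfl⟩ := hρ
  obtain ⟨φ, -, rfl⟩ := hσ
  rw [trace_vecMulVec_mul_vecMulVec_star, mul_eq_zero, star_eq_zero, or_self] at h
  rw [vecMulVec_mul_vecMulVec_star, h, zero_smul]

/-- The rank-1 projections onto the vectors of an orthonormal basis form a context. -/
lemma OrthonormalBasis.isContext_image {d : ℕ} {ι : Type*} [Fintype ι] [DecidableEq (Mat d)]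
    (b : OrthonormalBasis ι ℂ (EuclideanSpace ℂ (Fin d))) :
    IsContext (Finset.univ.image fun i => vecMulVec (b i).ofLp (star (b i).ofLp)) := by
  classical
  have hb (i j : ι) : star (b i).ofLp ⬝ᵥ (b j).ofLp = if i = j then 1 else 0 := by
    rw [← orthonormal_iff_ite.mp b.orthonormal i j, EuclideanSpace.inner_eq_star_dotProduct,
      dotProduct_comm]
  have hpure (i : ι) : IsPureState (vecMulVec (b i).ofLp (star (b i).ofLp)) :=
    ⟨_, by simp [hb], rfl⟩
  have horth (i j : ι) (hij : i ≠ j) : vecMulVec (b i).ofLp (star (b i).ofLp) *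
      vecMulVec (b j).ofLp (star (b j).ofLp) = 0 := by
    simp [vecMulVec_mul_vecMulVec_star, hb, hij]
  have hinj : Function.Injective fun i => vecMulVec (b i).ofLp (star (b i).ofLp) := by
    intro i j hij
    by_contra hne
    have h := horth i j hne
    simp only at hij
    rw [← hij, (hpure i).isProjection.2] at h
    exact (hpure i).ne_zero h
  refine ⟨?_, ?_, ?_⟩
  · simpa using hpure
  · simp only [Finset.mem_image, Finset.mem_univ, true_and]
    rintro _ ⟨i, rfl⟩ _ ⟨j, rfl⟩ hne
    exact horth i j fun h => hne (by rw [h])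
  · rw [Finset.sum_image hinj.injOn]
    refine Matrix.ext_of_mulVec_single fun k => ?_
    have h := congrArg WithLp.ofLp (b.sum_repr' (WithLp.toLp 2 (Pi.single k (1 : ℂ))))
    rw [one_mulVec, Matrix.sum_mulVec]
    refine Eq.trans ?_ h
    rw [WithLp.ofLp_sum]
    refine Finset.sum_congr rfl fun i _ => ?_
    ext l
    simp [EuclideanSpace.inner_eq_star_dotProduct, vecMulVec_apply, mul_comm]

/-- Two orthogonal pure states belong to a common context. -/
lemma exists_isContext_of_mul_eq_zero {d : ℕ} {ρ σ : Mat d} (hρ : IsPureState ρ)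
    (hσ : IsPureState σ) (h : ρ * σ = 0) : ∃ K : Finset (Mat d), IsContext K ∧ ρ ∈ K ∧ σ ∈ K := by
  classical
  have ht := (hρ.trace_mul_eq_zero_iff hσ).mpr h
  obtain ⟨ψ, hψ, rfl⟩ := hρ
  obtain ⟨φ, hφ, rfl⟩ := hσ
  rw [trace_vecMulVec_mul_vecMulVec_star, mul_eq_zero, star_eq_zero, or_self] at ht
  have ht' : star φ ⬝ᵥ ψ = 0 := by
    rw [star_dotProduct, ht, star_zero]
  have hv : Orthonormal ℂ
      ((↑) : ({WithLp.toLp 2 ψ, WithLp.toLp 2 φ} : Set (EuclideanSpace ℂ (Fin d))) →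
        EuclideanSpace ℂ (Fin d)) := by
    rw [orthonormal_subtype_iff_ite]
    have hne : WithLp.toLp 2 ψ ≠ WithLp.toLp 2 φ := fun h => by
      rw [← WithLp.toLp_injective 2 h, hψ] at ht
      exact one_ne_zero ht
    rintro _ (rfl | rfl) _ (rfl | rfl) <;>
      simp [-inner_self_eq_norm_sq_to_K, EuclideanSpace.inner_eq_star_dotProduct,
        dotProduct_comm _ (star _), *, hne.symm]
  obtain ⟨u, b, hu, hb⟩ := hv.exists_orthonormalBasis_extension
  refine ⟨_, b.isContext_image, Finset.mem_image.mpr ⟨⟨WithLp.toLp 2 ψ, hu (by simp)⟩, by simp, ?_⟩,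
    Finset.mem_image.mpr ⟨⟨WithLp.toLp 2 φ, hu (by simp)⟩, by simp, ?_⟩⟩ <;> simp [hb]

/-- A set of pure states that is weakly antidistinguished by a context is contextual. -/
lemma isContextualSet_of_isContext {d : ℕ} {S C : Finset (Mat d)}
    (hpure : ∀ ρ ∈ S, IsPureState ρ) (hC : IsContext C)
    (h : ∀ σ ∈ C, ∃ ρ ∈ S, ρ * σ = 0) : IsContextualSet S := by
  classical
  choose! r hrS hr using h
  have hK : ∀ σ ∈ C, ∃ K : Finset (Mat d), IsContext K ∧ r σ ∈ K ∧ σ ∈ K := fun σ hσ =>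
    exists_isContext_of_mul_eq_zero (hpure _ (hrS σ hσ)) (hC.1 σ hσ) (hr σ hσ)
  choose! K hK hrK hσK using hK
  have hKX : ∀ σ ∈ C, K σ ⊆ S ∪ C.biUnion K := fun σ hσ =>
    (Finset.subset_biUnion_of_mem K hσ).trans Finset.subset_union_right
  refine ⟨S ∪ C.biUnion K, ⟨?_, Finset.subset_union_left, ?_⟩, ?_⟩
  · intro τ hτ
    rcases Finset.mem_union.mp hτ with hτ | hτ
    · exact hpure τ hτ
    · obtain ⟨σ, hσ, hτσ⟩ := Finset.mem_biUnion.mp hτ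
      exact (hK σ hσ).1 τ hτσ
  · intro τ hτ hτS
    obtain ⟨σ, hσ, hτσ⟩ := Finset.mem_biUnion.mp ((Finset.mem_union.mp hτ).resolve_left hτS)
    exact ⟨(hK σ hσ).1 τ hτσ, r σ, hrS σ hσ, (hK σ hσ).2.1 _ (hrK σ hσ) _ hτσ fun h =>
      hτS (h ▸ hrS σ hσ)⟩
  · rintro ⟨ν, ⟨-, hν⟩, hνS⟩
    have hν0 : ∀ σ ∈ C, ν σ = 0 := by
      intro σ hσ
      have hne : r σ ≠ σ := fun h => by
        have h0 := hr σ hσ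
        rw [h, (hC.1 σ hσ).isProjection.2] at h0
        exact (hC.1 σ hσ).ne_zero h0
      have hsum := hν _ (hKX σ hσ) (hK σ hσ)
      have hle : ∑ τ ∈ {r σ, σ}, ν τ ≤ ∑ τ ∈ K σ, ν τ :=
        Finset.sum_le_sum_of_subset (by simp [Finset.insert_subset_iff, hrK σ hσ, hσK σ hσ])
      rw [Finset.sum_pair hne, hνS _ (hrS σ hσ), hsum] at hle
      omega
    have hsum := hν C (fun σ hσ => hKX σ hσ (hσK σ hσ)) hC
    rw [Finset.sum_eq_zero hν0] at hsum
    exact zero_ne_one hsum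

/-- A non-orthogonal contextual set is weakly antidistinguished by a context. -/
lemma IsContextualSet.exists_isContext {d : ℕ} {S : Finset (Mat d)} (h : IsContextualSet S)
    (hnon : NonOrthogonal S) : ∃ C : Finset (Mat d), IsContext C ∧ ∀ σ ∈ C, ∃ ρ ∈ S, ρ * σ = 0 := by
  classical
  obtain ⟨X, ⟨-, -, hX⟩, hinst⟩ := h
  by_contra! hC
  refine hinst ⟨fun σ => if σ ∈ S then 1 else 0, ⟨fun σ _ => ?_, fun C hCX hctx => ?_⟩,
    fun ρ hρ => if_pos hρ⟩
  · by_cases hσ : σ ∈ S <;> simp [hσ]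
  · obtain ⟨σ, hσ, hσS⟩ := hC C hctx
    have hmem : σ ∈ S := by
      by_contra hσ'
      obtain ⟨-, ρ, hρ, h0⟩ := hX σ (hCX hσ) hσ'
      exact hσS ρ hρ h0
    rw [Finset.sum_eq_single_of_mem σ hσ, if_pos hmem]
    intro τ hτ hne
    refine if_neg fun hτS => hnon τ hτS σ hmem hne ?_
    rw [hctx.2.1 τ hτ σ hσ hne, trace_zero]

/-- A finite non-orthogonal set of pure states that is maximally
contextual is strongly antidistinguishable. -/
theorem statement_2 {d : ℕ} (S : Finset (Mat d))
    (hpure : ∀ ρ ∈ S, IsPureState ρ) (hnon : NonOrthogonal S)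
    (hmax : MaximallyContextual S) :
    IsSA S := by
  classical
  obtain ⟨C, hC, hex⟩ := hmax.1.exists_isContext hnon
  have htr : ∀ σ ∈ C, ∀ ρ ∈ S, (σ * ρ).trace = 0 ↔ ρ * σ = 0 := fun σ hσ ρ hρ => by
    rw [trace_mul_comm, (hpure ρ hρ).trace_mul_eq_zero_iff (hC.1 σ hσ)]
  refine ⟨C, ⟨fun p hp => (hC.1 p hp).isProjection, hC.2⟩, fun p hp => ?_, fun ρ hρ => ?_⟩
  · obtain ⟨ρ, hρ, h0⟩ := hex p hp
    exact ⟨ρ, hρ, (htr p hp ρ hρ).mpr h0⟩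
  · by_contra! hcon
    refine hmax.2 _ (Finset.erase_ssubset hρ) (isContextualSet_of_isContext
      (fun τ hτ => hpure τ (Finset.mem_of_mem_erase hτ)) hC fun σ hσ => ?_)
    obtain ⟨τ, hτ, h0⟩ := hex σ hσ
    by_cases hτρ : τ = ρ
    · subst hτρ
      obtain ⟨ρ', hρ', hne, h0'⟩ := hcon σ hσ ((htr σ hσ τ hτ).mpr h0)
      exact ⟨ρ', Finset.mem_erase.mpr ⟨hne, hρ'⟩, (htr σ hσ ρ' hρ').mp h0'⟩
    · exact ⟨τ, Finset.mem_erase.mpr ⟨hτρ, hτ⟩, h0⟩
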